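/- For a symmetric free polynomial p ∈ ℝ⟨x⟩ the following are equivalent: (i) there exist a polynomial ℓ homogeneous of degree one and finitely many polynomials sⱼ homogeneous of degree one such that p − p(0) = ℓ + Σⱼ sⱼ* sⱼ; (ii) p is matrix convex, i.e. for every n, every pair X, Y ∈ 𝕊ₙ(ℝ^g) and every t ∈ [0,1], p(tX + (1−t)Y) ⪯ tp(X) + (1−t)p(Y); (iii) for every n and every A ∈ 𝕊ₙ(ℝ) the set D(A) = {X ∈ 𝕊ₙ(ℝ^g) : A − p(X) is positive definite} is convex; (iv) p − p(0) is quasi-convex and p(0) − p is not a nonzero hermitian sum of squares. -/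

import Mathlib

open scoped BigOperators

noncomputable section

/-- Evaluation of a free polynomial `p ∈ ℝ⟨x₁,…,x_g⟩` at a `g`-tuple of square matrices;
the empty word evaluates to the identity matrix. -/
def evalMat {g : ℕ} {ι : Type} [Fintype ι] [DecidableEq ι]
    (p : FreeAlgebra ℝ (Fin g)) (X : Fin g → Matrix ι ι ℝ) : Matrix ι ι ℝ :=
  FreeAlgebra.lift ℝ X p

/-- `p` is a hermitian sum of squares: `p = Σⱼ hⱼ* hⱼ`. -/
def IsHermitianSOS {g : ℕ} (p : FreeAlgebra ℝ (Fin g)) : Prop :=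
  ∃ (m : ℕ) (h : Fin m → FreeAlgebra ℝ (Fin g)), p = ∑ j, star (h j) * h j

/-- `p` is quasi-convex: `p(0) = 0` and for every positive integer `n` and every
positive definite `A ∈ 𝕊ₙ(ℝ)`, the set `{X ∈ 𝕊ₙ(ℝ^g) : A − p(X) ≻ 0}` is convex. -/
def IsQuasiConvex {g : ℕ} (p : FreeAlgebra ℝ (Fin g)) : Prop :=
  (∀ n : ℕ, evalMat p (fun _ => (0 : Matrix (Fin n) (Fin n) ℝ)) = 0) ∧
  ∀ n : ℕ, 0 < n → ∀ A : Matrix (Fin n) (Fin n) ℝ, A.PosDef →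
    Convex ℝ {X : Fin g → Matrix (Fin n) (Fin n) ℝ |
      (∀ j, (X j).IsSymm) ∧ (A - evalMat p X).PosDef}

/-- The space of free polynomials homogeneous of degree one (linear span of the variables).  -/
def degOne (g : ℕ) : Submodule ℝ (FreeAlgebra ℝ (Fin g)) :=
  Submodule.span ℝ (Set.range (FreeAlgebra.ι ℝ : Fin g → FreeAlgebra ℝ (Fin g)))

/-- The space of free polynomials of degree at most `k`. -/
def degLE (g k : ℕ) : Submodule ℝ (FreeAlgebra ℝ (Fin g)) :=
  ⨆ i ∈ Finset.range (k + 1), (degOne g) ^ i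

/-- `M` has a positive eigenvalue (with corresponding eigenvector). -/
def HasPosEigenvalue {n : ℕ} (M : Matrix (Fin n) (Fin n) ℝ) : Prop :=
  ∃ (lam : ℝ) (v : Fin n → ℝ), 0 < lam ∧ v ≠ 0 ∧ M.mulVec v = lam • v

/-- The directional derivative `p′(X)[H]`: the coefficient of `t` in `t ↦ p(X + tH)`. -/
def derivEval {g n : ℕ} (p : FreeAlgebra ℝ (Fin g))
    (X H : Fin g → Matrix (Fin n) (Fin n) ℝ) : Matrix (Fin n) (Fin n) ℝ :=
  (FreeAlgebra.lift ℝ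
      (fun j => Polynomial.C (X j) + Polynomial.X * Polynomial.C (H j)) p).coeff 1

/-- The Hessian `p″(X)[H]`: twice the coefficient of `t²` in `t ↦ p(X + tH)`. -/
def hessEval {g n : ℕ} (p : FreeAlgebra ℝ (Fin g))
    (X H : Fin g → Matrix (Fin n) (Fin n) ℝ) : Matrix (Fin n) (Fin n) ℝ :=
  (2 : ℝ) • (FreeAlgebra.lift ℝ
      (fun j => Polynomial.C (X j) + Polynomial.X * Polynomial.C (H j)) p).coeff 2

/-- The constant term of a free polynomial (so that `p(0)` is `constantTerm p` times the
identity matrix). -/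
def constantTerm {g : ℕ} (p : FreeAlgebra ℝ (Fin g)) : ℝ :=
  FreeAlgebra.lift ℝ (fun _ : Fin g => (0 : ℝ)) p

/-- Evaluation of a word `w = x_{j₁}⋯x_{j_k}` at a tuple of matrices: `X_{j₁}⋯X_{j_k}`. -/
def wordEval {g n : ℕ} (X : Fin g → Matrix (Fin n) (Fin n) ℝ)
    (w : FreeMonoid (Fin g)) : Matrix (Fin n) (Fin n) ℝ :=
  (w.toList.map X).prod

/-- Condition (i): `p − p(0)` is a hermitian sum of squares of degree-one homogeneous
polynomials plus a degree-one homogeneous term. -/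
def Cond1 (g : ℕ) (p : FreeAlgebra ℝ (Fin g)) : Prop :=
  ∃ (l : FreeAlgebra ℝ (Fin g)) (m : ℕ) (s : Fin m → FreeAlgebra ℝ (Fin g)),
    l ∈ degOne g ∧ (∀ j, s j ∈ degOne g) ∧
    p - algebraMap ℝ (FreeAlgebra ℝ (Fin g)) (constantTerm p) = l + ∑ j, star (s j) * s j

/-- Condition (ii): `p` is matrix convex. -/
def Cond2 (g : ℕ) (p : FreeAlgebra ℝ (Fin g)) : Prop :=
  ∀ n : ℕ, 0 < n → ∀ X Y : Fin g → Matrix (Fin n) (Fin n) ℝ,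
    (∀ j, (X j).IsSymm) → (∀ j, (Y j).IsSymm) → ∀ t : ℝ, 0 ≤ t → t ≤ 1 →
    (t • evalMat p X + (1 - t) • evalMat p Y -
      evalMat p (fun j => t • X j + (1 - t) • Y j)).PosSemidef

/-- Condition (iii): `D(A)` is convex for every symmetric `A`. -/
def Cond3 (g : ℕ) (p : FreeAlgebra ℝ (Fin g)) : Prop :=
  ∀ n : ℕ, 0 < n → ∀ A : Matrix (Fin n) (Fin n) ℝ, A.IsSymm →
    Convex ℝ {X : Fin g → Matrix (Fin n) (Fin n) ℝ |
      (∀ j, (X j).IsSymm) ∧ (A - evalMat p X).PosDef}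

/-- Condition (iv): `p − p(0)` is quasi-convex and `p(0) − p` is not a nonzero hermitian sum
of squares. -/
def Cond4 (g : ℕ) (p : FreeAlgebra ℝ (Fin g)) : Prop :=
  IsQuasiConvex (p - algebraMap ℝ (FreeAlgebra ℝ (Fin g)) (constantTerm p)) ∧
  ¬ (IsHermitianSOS (algebraMap ℝ (FreeAlgebra ℝ (Fin g)) (constantTerm p) - p) ∧
      algebraMap ℝ (FreeAlgebra ℝ (Fin g)) (constantTerm p) - p ≠ 0)

open Matrix

/-- The monomial attached to a word. -/
def wordMonomial {g : ℕ} (w : List (Fin g)) : FreeAlgebra ℝ (Fin g) :=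
  (w.map (FreeAlgebra.ι ℝ)).prod

theorem wordMonomial_append {g : ℕ} (u w : List (Fin g)) :
    wordMonomial (u ++ w) = wordMonomial u * wordMonomial w := by
  simp [wordMonomial]

theorem star_wordMonomial {g : ℕ} (w : List (Fin g)) :
    star (wordMonomial w) = wordMonomial w.reverse := by
  induction w with
  | nil => simp [wordMonomial]
  | cons j w ih =>
    rw [List.reverse_cons, wordMonomial_append, ← ih]
    simp [wordMonomial]

theorem star_smul_real {g : ℕ} (r : ℝ) (p : FreeAlgebra ℝ (Fin g)) :
    star (r • p) = r • star p := by
  rw [Algebra.smul_def, star_mul, FreeAlgebra.star_algebraMap, Algebra.smul_def,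
    Algebra.commutes]

/-- The coefficients of a free polynomial, indexed by words. -/
def wordCoeff {g : ℕ} : FreeAlgebra ℝ (Fin g) ≃ₗ[ℝ] (List (Fin g) →₀ ℝ) :=
  (FreeAlgebra.equivMonoidAlgebraFreeMonoid.toLinearEquiv.trans
    (MonoidAlgebra.coeffLinearEquiv ℝ)).trans (Finsupp.domLCongr FreeMonoid.toList)

theorem wordCoeff_wordMonomial {g : ℕ} (w : List (Fin g)) :
    wordCoeff (wordMonomial w) = Finsupp.single w 1 := by
  have h : FreeAlgebra.equivMonoidAlgebraFreeMonoid (wordMonomial w) =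
      MonoidAlgebra.single (FreeMonoid.ofList w) (1 : ℝ) := by
    induction w with
    | nil => simp [wordMonomial, MonoidAlgebra.one_def]
    | cons j w ih =>
      have : wordMonomial (j :: w) = FreeAlgebra.ι ℝ j * wordMonomial w := by simp [wordMonomial]
      rw [this, map_mul, ih]
      simp [FreeAlgebra.equivMonoidAlgebraFreeMonoid, MonoidAlgebra.single_mul_single]
  simp [wordCoeff, h]

theorem wordCoeff_symm_apply {g : ℕ} (f : List (Fin g) →₀ ℝ) :
    wordCoeff.symm f = f.sum fun w r => r • wordMonomial w := by
  rw [LinearEquiv.symm_apply_eq]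
  simp only [Finsupp.sum, map_sum, map_smul, wordCoeff_wordMonomial, Finsupp.smul_single,
    smul_eq_mul, mul_one]
  exact (Finsupp.sum_single f).symm

theorem eq_sum_wordCoeff {g : ℕ} (p : FreeAlgebra ℝ (Fin g)) :
    p = (wordCoeff p).sum fun w r => r • wordMonomial w := by
  rw [← wordCoeff_symm_apply, LinearEquiv.symm_apply_apply]

theorem wordCoeff_star {g : ℕ} (p : FreeAlgebra ℝ (Fin g)) (w : List (Fin g)) :
    wordCoeff (star p) w = wordCoeff p w.reverse := by
  classical
  obtain ⟨f, rfl⟩ := wordCoeff.symm.surjective p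
  rw [LinearEquiv.apply_symm_apply, wordCoeff_symm_apply]
  simp only [Finsupp.sum, star_sum, star_smul_real, star_wordMonomial, map_sum, map_smul,
    wordCoeff_wordMonomial, Finsupp.finsetSum_apply, Finsupp.smul_apply, Finsupp.single_apply,
    smul_eq_mul, mul_ite, mul_one, mul_zero]
  have : ∀ u : List (Fin g), (u.reverse = w) ↔ (u = w.reverse) := fun u =>
    List.reverse_eq_iff
  simp only [this, Finset.sum_ite_eq', Finsupp.mem_support_iff, ite_not, ite_eq_right_iff]
  exact fun h => h.symm

/-- The product of matrices along a word. -/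
def wordProd {g : ℕ} {ι : Type} [Fintype ι] [DecidableEq ι]
    (X : Fin g → Matrix ι ι ℝ) (w : List (Fin g)) : Matrix ι ι ℝ :=
  (w.map X).prod

section wordProd

variable {g : ℕ} {ι : Type} [Fintype ι] [DecidableEq ι]

@[simp] theorem wordProd_nil (X : Fin g → Matrix ι ι ℝ) : wordProd X [] = 1 := rfl

@[simp] theorem wordProd_cons (X : Fin g → Matrix ι ι ℝ) (j : Fin g) (w : List (Fin g)) :
    wordProd X (j :: w) = X j * wordProd X w := by simp [wordProd]

theorem wordProd_append (X : Fin g → Matrix ι ι ℝ) (u w : List (Fin g)) :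
    wordProd X (u ++ w) = wordProd X u * wordProd X w := by simp [wordProd]

theorem transpose_wordProd {X : Fin g → Matrix ι ι ℝ} (hX : ∀ j, (X j).IsSymm)
    (w : List (Fin g)) : (wordProd X w)ᵀ = wordProd X w.reverse := by
  induction w with
  | nil => simp
  | cons j w ih => rw [wordProd_cons, Matrix.transpose_mul, ih, (hX j).eq, List.reverse_cons,
      wordProd_append]; simp

theorem evalMat_wordMonomial (X : Fin g → Matrix ι ι ℝ) (w : List (Fin g)) :
    evalMat (wordMonomial w) X = wordProd X w := by
  simp [evalMat, wordMonomial, wordProd, map_list_prod, List.map_map, Function.comp_def]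

theorem evalMat_eq_sum (p : FreeAlgebra ℝ (Fin g)) (X : Fin g → Matrix ι ι ℝ) :
    evalMat p X = (wordCoeff p).sum fun w r => r • wordProd X w := by
  conv_lhs => rw [eq_sum_wordCoeff p]
  simp only [evalMat, Finsupp.sum, map_sum, map_smul]
  simp only [← evalMat_wordMonomial, evalMat]

theorem evalMat_star {X : Fin g → Matrix ι ι ℝ} (hX : ∀ j, (X j).IsSymm)
    (p : FreeAlgebra ℝ (Fin g)) : evalMat (star p) X = (evalMat p X)ᵀ := by
  rw [evalMat_eq_sum p]
  conv_lhs => rw [eq_sum_wordCoeff p]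
  simp only [Finsupp.sum, star_sum, star_smul_real, star_wordMonomial, evalMat, map_sum, map_smul,
    Matrix.transpose_sum, Matrix.transpose_smul, transpose_wordProd hX]
  simp only [← evalMat_wordMonomial, evalMat]

theorem evalMat_isSymm {X : Fin g → Matrix ι ι ℝ} (hX : ∀ j, (X j).IsSymm)
    {p : FreeAlgebra ℝ (Fin g)} (hp : star p = p) : (evalMat p X).IsSymm := by
  rw [Matrix.IsSymm, ← evalMat_star hX, hp]

end wordProd

theorem constantTerm_eq_wordCoeff {g : ℕ} (p : FreeAlgebra ℝ (Fin g)) :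
    constantTerm p = wordCoeff p [] := by
  obtain ⟨f, rfl⟩ := wordCoeff.symm.surjective p
  rw [LinearEquiv.apply_symm_apply, wordCoeff_symm_apply]
  simp only [constantTerm, Finsupp.sum, map_sum, map_smul, wordMonomial, map_list_prod,
    List.map_map, Function.comp_def, FreeAlgebra.lift_ι_apply, List.map_const', List.prod_replicate,
    smul_eq_mul]
  rw [Finset.sum_eq_single []]
  · simp
  · intro w _ hw
    simp [hw]
  · simp +contextual

theorem algebraMap_eq_smul_wordMonomial {g : ℕ} (c : ℝ) :
    algebraMap ℝ (FreeAlgebra ℝ (Fin g)) c = c • wordMonomial [] := by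
  simp [wordMonomial, Algebra.algebraMap_eq_smul_one]

section Factorization

open scoped MatrixOrder

theorem Matrix.PosSemidef.exists_eq_transpose_mul_self {ι : Type} [Fintype ι] [DecidableEq ι]
    {G : Matrix ι ι ℝ} (hG : G.PosSemidef) : ∃ B : Matrix ι ι ℝ, G = Bᵀ * B := by
  obtain ⟨B, hB⟩ := CStarAlgebra.nonneg_iff_eq_star_mul_self.mp
    (Matrix.nonneg_iff_posSemidef.mpr hG)
  exact ⟨B, by rw [hB, Matrix.star_eq_conjTranspose, Matrix.conjTranspose_eq_transpose_of_trivial]⟩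

theorem Matrix.PosDef.exists_isUnit_eq_transpose_mul_self {ι : Type} [Fintype ι] [DecidableEq ι]
    {G : Matrix ι ι ℝ} (hG : G.PosDef) : ∃ B : Matrix ι ι ℝ, IsUnit B ∧ G = Bᵀ * B := by
  obtain ⟨B, hB⟩ := hG.posSemidef.exists_eq_transpose_mul_self
  refine ⟨B, ?_, hB⟩
  have h := hG.isUnit
  rw [Matrix.isUnit_iff_isUnit_det] at h ⊢
  rw [hB, Matrix.det_mul] at h
  exact isUnit_of_mul_isUnit_right h

end Factorization

/-- Words of length at most `k`. -/
abbrev WordsLE (g k : ℕ) : Type := {w : List (Fin g) // w.length ≤ k}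

instance (g k : ℕ) : Fintype (WordsLE g k) :=
  (List.finite_length_le (Fin g) k).fintype

/-- The truncated Hankel matrix of a functional on words. -/
def hankel {g : ℕ} (k : ℕ) (L : List (Fin g) → ℝ) : Matrix (WordsLE g k) (WordsLE g k) ℝ :=
  Matrix.of fun u w => L (u.1.reverse ++ w.1)

/-- Truncated Gelfand–Naimark–Segal construction. -/
theorem exists_wordProd_mulVec_eq {g k : ℕ} {L : List (Fin g) → ℝ}
    (hL : ∀ w, L w.reverse = L w) (hpos : (hankel k L).PosDef) :
    ∃ (X : Fin g → Matrix (WordsLE g k) (WordsLE g k) ℝ) (v : WordsLE g k → ℝ)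
      (R : Matrix (WordsLE g k) (WordsLE g k) ℝ),
      (∀ j, (X j).IsSymm) ∧ IsUnit R ∧ hankel k L = Rᵀ * R ∧
      ∀ w : WordsLE g k, wordProd X w.1 *ᵥ v = R *ᵥ Pi.single w 1 := by
  obtain ⟨R, hR, hM⟩ := hpos.exists_isUnit_eq_transpose_mul_self
  have hdet : IsUnit R.det := (Matrix.isUnit_iff_isUnit_det R).mp hR
  have hdetT : IsUnit Rᵀ.det := by rwa [Matrix.det_transpose]
  let N : Fin g → Matrix (WordsLE g k) (WordsLE g k) ℝ := fun j =>
    Matrix.of fun u w => L (u.1.reverse ++ j :: w.1)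
  have hN : ∀ j, (N j)ᵀ = N j := by
    intro j
    ext u w
    simp only [N, Matrix.transpose_apply, Matrix.of_apply]
    rw [← hL]
    simp
  refine ⟨fun j => (R⁻¹)ᵀ * N j * R⁻¹, R *ᵥ Pi.single ⟨[], Nat.zero_le k⟩ 1, R, ?_, hR, hM, ?_⟩
  · intro j
    rw [Matrix.IsSymm, Matrix.transpose_mul, Matrix.transpose_mul, hN, Matrix.transpose_transpose]
    exact (Matrix.mul_assoc _ _ _).symm
  · rintro ⟨w, hw⟩
    induction w with
    | nil => simp
    | cons j w ih =>
      have hw' : w.length ≤ k := (Nat.le_succ _).trans hw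
      have key : N j *ᵥ Pi.single ⟨w, hw'⟩ 1 = hankel k L *ᵥ Pi.single ⟨j :: w, hw⟩ 1 := by
        ext u
        simp [N, hankel]
      rw [wordProd_cons, ← Matrix.mulVec_mulVec, ih hw', Matrix.mulVec_mulVec, Matrix.mul_assoc,
        Matrix.nonsing_inv_mul R hdet, Matrix.mul_one, ← Matrix.mulVec_mulVec, key, hM,
        Matrix.mulVec_mulVec, ← Matrix.mul_assoc, ← Matrix.transpose_mul,
        Matrix.mul_nonsing_inv R hdet, Matrix.transpose_one, Matrix.one_mul]

/-- The free polynomial with a given Gram matrix. -/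
def gramPoly {g k : ℕ} :
    Matrix (WordsLE g k) (WordsLE g k) ℝ →ₗ[ℝ] FreeAlgebra ℝ (Fin g) where
  toFun G := ∑ u, ∑ w, G u w • wordMonomial (u.1.reverse ++ w.1)
  map_add' G H := by simp [add_smul, Finset.sum_add_distrib]
  map_smul' c G := by simp [Finset.smul_sum, mul_smul]

theorem gramPoly_apply {g k : ℕ} (G : Matrix (WordsLE g k) (WordsLE g k) ℝ) :
    gramPoly G = ∑ u, ∑ w, G u w • wordMonomial (u.1.reverse ++ w.1) := rfl

theorem wordCoeff_gramPoly {g k : ℕ} (G : Matrix (WordsLE g k) (WordsLE g k) ℝ)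
    (m : List (Fin g)) :
    wordCoeff (gramPoly G) m = ∑ u, ∑ w, if u.1.reverse ++ w.1 = m then G u w else 0 := by
  simp [gramPoly_apply, map_sum, wordCoeff_wordMonomial, Finsupp.finsetSum_apply,
    Finsupp.single_apply]

theorem isHermitianSOS_gramPoly {g k : ℕ} {G : Matrix (WordsLE g k) (WordsLE g k) ℝ}
    (hG : G.PosSemidef) : IsHermitianSOS (gramPoly G) := by
  obtain ⟨B, rfl⟩ := hG.exists_eq_transpose_mul_self
  let e := Fintype.equivFin (WordsLE g k)
  refine ⟨_, fun i => ∑ u, B (e.symm i) u • wordMonomial u.1, ?_⟩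
  rw [e.symm.sum_comp (fun i => star (∑ u, B i u • wordMonomial u.1) *
    ∑ u, B i u • wordMonomial u.1)]
  simp only [star_sum, star_smul_real, star_wordMonomial, Finset.sum_mul_sum, smul_mul_smul_comm,
    ← wordMonomial_append, gramPoly_apply, Matrix.mul_apply, Matrix.transpose_apply,
    Finset.sum_smul]
  rw [Finset.sum_comm_cycle]

theorem IsHermitianSOS.smul {g : ℕ} {p : FreeAlgebra ℝ (Fin g)} (hp : IsHermitianSOS p) {c : ℝ}
    (hc : 0 ≤ c) : IsHermitianSOS (c • p) := by
  obtain ⟨m, h, rfl⟩ := hp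
  refine ⟨m, fun j => √c • h j, ?_⟩
  simp only [star_smul_real, smul_mul_smul_comm, Real.mul_self_sqrt hc, Finset.smul_sum]

theorem Matrix.PosSemidef.apply_eq_zero_of_diag {ι : Type} [Fintype ι] [DecidableEq ι]
    {G : Matrix ι ι ℝ} (hG : G.PosSemidef) {i : ι} (hi : G i i = 0) (j : ι) :
    G i j = 0 ∧ G j i = 0 := by
  obtain ⟨B, rfl⟩ := hG.exists_eq_transpose_mul_self
  have h : ∀ a, B a i = 0 := by
    intro a
    simp only [Matrix.mul_apply, Matrix.transpose_apply] at hi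
    exact mul_self_eq_zero.mp
      ((Finset.sum_eq_zero_iff_of_nonneg fun a _ => mul_self_nonneg (B a i)).mp hi a
        (Finset.mem_univ a))
  simp [Matrix.mul_apply, h]

theorem eq_zero_of_gramPoly_eq_zero {g k : ℕ} {G : Matrix (WordsLE g k) (WordsLE g k) ℝ}
    (hG : G.PosSemidef) (h0 : gramPoly G = 0) : G = 0 := by
  have key : ∀ d, ∀ u : WordsLE g k, k < u.1.length + d → G u u = 0 := by
    intro d
    induction d with
    | zero => exact fun u hu => absurd u.2 (not_le.mpr hu)
    | succ d ih =>
      intro u hu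
      have h := wordCoeff_gramPoly G (u.1.reverse ++ u.1)
      rw [h0, map_zero, Finsupp.zero_apply, Finset.sum_eq_single u, Finset.sum_eq_single u] at h
      · simpa using h.symm
      · intro w _ hw
        simp [Subtype.coe_inj, hw]
      · simp
      · intro w _ hw
        refine Finset.sum_eq_zero fun z _ => ?_
        split_ifs with hz
        · have hl := congrArg List.length hz
          simp only [List.length_append, List.length_reverse] at hl
          rcases lt_trichotomy w.1.length u.1.length with hlt | heq | hgt
          · exact (hG.apply_eq_zero_of_diag (ih z (by omega)) w).2
          · refine absurd ?_ hw
            exact Subtype.ext (List.reverse_injective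
              (List.append_inj hz (by simpa using heq)).1)
          · exact (hG.apply_eq_zero_of_diag (ih w (by omega)) z).1
        · rfl
      · simp
  ext u w
  exact (hG.apply_eq_zero_of_diag (key (k + 1) u (by omega)) w).1

theorem isCompact_posSemidef_trace_eq_one (ι : Type) [Fintype ι] [DecidableEq ι] :
    IsCompact {G : Matrix ι ι ℝ | G.PosSemidef ∧ G.trace = 1} := by
  have hbox : IsCompact (Set.univ.pi fun _ : ι => Set.univ.pi fun _ : ι => Set.Icc (-1 : ℝ) 1) :=
    isCompact_univ_pi fun _ => isCompact_univ_pi fun _ => isCompact_Icc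
  refine IsCompact.of_isClosed_subset hbox ?_ ?_
  · have : {G : Matrix ι ι ℝ | G.PosSemidef ∧ G.trace = 1} =
        ({G | Gᵀ = G} ∩ ⋂ x : ι → ℝ, {G | 0 ≤ x ⬝ᵥ (G *ᵥ x)}) ∩ {G | G.trace = 1} := by
      ext G
      simp [Matrix.posSemidef_iff_dotProduct_mulVec, Matrix.IsHermitian]
    rw [this]
    refine ((isClosed_eq (by fun_prop) continuous_id).inter
      (isClosed_iInter fun x => isClosed_le continuous_const ?_)).inter
        (isClosed_eq ?_ continuous_const)
    · simp only [dotProduct, Matrix.mulVec]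
      fun_prop
    · exact continuous_finsetSum _ fun i _ => by fun_prop
  · rintro G ⟨hG, htr⟩
    have hd : ∀ i, 0 ≤ G i i := fun i => hG.diag_nonneg
    have hd1 : ∀ i, G i i ≤ 1 := by
      intro i
      rw [← htr]
      exact Finset.single_le_sum (f := fun i => G i i) (fun i _ => hd i) (Finset.mem_univ i)
    refine Set.mem_univ_pi.mpr fun i => Set.mem_univ_pi.mpr fun j => ?_
    have hs : G j i = G i j := by simpa using hG.isHermitian.apply i j
    have h1 := hG.dotProduct_mulVec_nonneg (Pi.single i 1 + Pi.single j 1)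
    have h2 := hG.dotProduct_mulVec_nonneg (Pi.single i 1 - Pi.single j 1)
    simp [Matrix.mulVec_add, Matrix.mulVec_sub] at h1 h2
    have := hd1 i
    have := hd1 j
    constructor <;> linarith

/-- A free polynomial which is not a hermitian sum of squares is strictly separated from the sums
of squares of polynomials of degree at most `k` by a strictly positive functional. -/
theorem exists_linearMap_pos {g : ℕ} {q : FreeAlgebra ℝ (Fin g)} (hq : ¬ IsHermitianSOS (-q))
    (k : ℕ) : ∃ Λ : FreeAlgebra ℝ (Fin g) →ₗ[ℝ] ℝ,
      (∀ G : Matrix (WordsLE g k) (WordsLE g k) ℝ, G.PosSemidef → G ≠ 0 → 0 < Λ (gramPoly G)) ∧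
      0 < Λ q := by
  let c : FreeAlgebra ℝ (Fin g) →ₗ[ℝ] (List (Fin g) → ℝ) :=
    Finsupp.lcoeFun ∘ₗ wordCoeff.toLinearMap
  have hc : Function.Injective c := fun a b hab =>
    wordCoeff.injective (DFunLike.coe_injective hab)
  let S : Set (Matrix (WordsLE g k) (WordsLE g k) ℝ) := {G | G.PosSemidef ∧ G.trace = 1}
  let P := c (-q)
  have hq0 : q ≠ 0 := by
    rintro rfl
    exact hq ⟨0, Fin.elim0, by simp⟩
  have hP : P ≠ 0 := fun h => hq0 (neg_eq_zero.mp (hc (h.trans (map_zero c).symm)))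
  obtain ⟨w₀, hw₀⟩ := Function.ne_iff.mp hP
  rw [Pi.zero_apply] at hw₀
  have hSconv : Convex ℝ S := by
    rintro G ⟨hG, hGt⟩ H ⟨hH, hHt⟩ a b ha hb hab
    exact ⟨(hG.smul ha).add (hH.smul hb), by simp [hGt, hHt, hab]⟩
  have hKconv : Convex ℝ ((c ∘ₗ gramPoly) '' S) := hSconv.linear_image _
  have hKcomp : IsCompact ((c ∘ₗ gramPoly) '' S) :=
    (isCompact_posSemidef_trace_eq_one _).image (LinearMap.continuous_of_finiteDimensional _)
  have hRconv : Convex ℝ {x | ∃ s : ℝ, 0 ≤ s ∧ x = s • P} := by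
    rintro _ ⟨s, hs, rfl⟩ _ ⟨t, ht, rfl⟩ a b ha hb -
    exact ⟨a * s + b * t, by positivity, by simp [add_smul, mul_smul]⟩
  have hRclosed : IsClosed {x | ∃ s : ℝ, 0 ≤ s ∧ x = s • P} := by
    have : {x | ∃ s : ℝ, 0 ≤ s ∧ x = s • P} =
        {x | 0 ≤ x w₀ / P w₀} ∩ {x | x = (x w₀ / P w₀) • P} := by
      ext x
      constructor
      · rintro ⟨s, hs, rfl⟩
        simp [hw₀, hs]
      · rintro ⟨h1, h2⟩
        exact ⟨_, h1, h2⟩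
    rw [this]
    exact (isClosed_le (by fun_prop) (by fun_prop)).inter (isClosed_eq (by fun_prop) (by fun_prop))
  have hdisj : Disjoint ((c ∘ₗ gramPoly) '' S) {x | ∃ s : ℝ, 0 ≤ s ∧ x = s • P} := by
    rw [Set.disjoint_left]
    rintro _ ⟨G, ⟨hG, htr⟩, rfl⟩ ⟨s, hs, h⟩
    have hGs : gramPoly G = s • (-q) := hc (by simpa [P] using h)
    rcases hs.eq_or_lt with rfl | hs
    · rw [zero_smul] at hGs
      rw [eq_zero_of_gramPoly_eq_zero hG hGs] at htr
      simp at htr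
    · apply hq
      have := (isHermitianSOS_gramPoly hG).smul (inv_nonneg.mpr hs.le)
      rwa [hGs, inv_smul_smul₀ hs.ne'] at this
  obtain ⟨f, u, v, hu, huv, hv⟩ :=
    geometric_hahn_banach_compact_closed hKconv hKcomp hRconv hRclosed hdisj
  have hv0 : v < 0 := by simpa using hv 0 ⟨0, le_rfl, by simp⟩
  have hfP : 0 ≤ f P := by
    by_contra! hneg
    have := hv ((v / f P) • P) ⟨_, (div_pos_of_neg_of_neg hv0 hneg).le, rfl⟩
    rw [map_smul, smul_eq_mul, div_mul_cancel₀ _ hneg.ne] at this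
    exact lt_irrefl _ this
  obtain ⟨C, hC⟩ := hKcomp.exists_bound_of_continuousOn
    (f := fun x : List (Fin g) → ℝ => x w₀ * P w₀) (by fun_prop)
  let δ : ℝ := -u / (|C| + 1)
  have hC1 : 0 < |C| + 1 := by positivity
  have hδ : 0 < δ := div_pos (by linarith) hC1
  have hδC : δ * (|C| + 1) = -u := div_mul_cancel₀ _ hC1.ne'
  let Λ : FreeAlgebra ℝ (Fin g) →ₗ[ℝ] ℝ :=
    -(f.toLinearMap + (δ * P w₀) • LinearMap.proj w₀) ∘ₗ c
  have hΛ : ∀ p, Λ p = -(f (c p) + δ * P w₀ * c p w₀) := fun p => rfl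
  have hS : ∀ G ∈ S, 0 < Λ (gramPoly G) := by
    intro G hG
    rw [hΛ]
    have h1 := hu _ ⟨G, hG, rfl⟩
    have h2 := (le_abs_self _).trans ((hC _ ⟨G, hG, rfl⟩).trans (le_abs_self C))
    simp only [LinearMap.comp_apply] at h1 h2
    nlinarith
  refine ⟨Λ, fun G hG hG0 => ?_, ?_⟩
  · have htr : 0 < G.trace := hG.trace_nonneg.lt_of_ne fun h => hG0 (hG.trace_eq_zero_iff.mp h.symm)
    have h := hS (G.trace⁻¹ • G) ⟨hG.smul (inv_nonneg.mpr htr.le), by simp [htr.ne']⟩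
    rw [map_smul, map_smul, smul_eq_mul] at h
    exact (pos_iff_pos_of_mul_pos h).mp (inv_pos.mpr htr)
  · have hcq : c q = -P := by simp [P]
    rw [hΛ, hcq, map_neg, Pi.neg_apply]
    have := mul_pos hδ (mul_self_pos.mpr hw₀)
    linarith

/-- A free polynomial `q` such that `-q` is not a hermitian sum of squares has a positive value,
attained at a tuple and a vector which are free up to any prescribed degree. -/
theorem exists_pos_evalMat {g : ℕ} {q : FreeAlgebra ℝ (Fin g)} (hsym : star q = q)
    (hq : ¬ IsHermitianSOS (-q)) {k : ℕ} (hk : ∀ w ∈ (wordCoeff q).support, w.length ≤ k) :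
    ∃ (X : Fin g → Matrix (WordsLE g k) (WordsLE g k) ℝ) (v : WordsLE g k → ℝ)
      (R : Matrix (WordsLE g k) (WordsLE g k) ℝ),
      (∀ j, (X j).IsSymm) ∧ IsUnit R ∧
      (∀ w : WordsLE g k, wordProd X w.1 *ᵥ v = R *ᵥ Pi.single w 1) ∧
      0 < v ⬝ᵥ (evalMat q X *ᵥ v) := by
  obtain ⟨Λ, hΛ, hΛq⟩ := exists_linearMap_pos hq k
  let L : List (Fin g) → ℝ := fun w => (Λ (wordMonomial w) + Λ (wordMonomial w.reverse)) / 2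
  have hL : ∀ w, L w.reverse = L w := fun w => by simp [L, add_comm]
  have hherm : (hankel k L).IsHermitian := by
    ext u w
    simp only [hankel, Matrix.conjTranspose_apply, Matrix.of_apply, star_trivial]
    rw [← hL]
    simp
  have hpos : (hankel k L).PosDef := by
    refine Matrix.PosDef.of_dotProduct_mulVec_pos hherm fun x hx => ?_
    have h := hΛ (Matrix.vecMulVec x x)
      (by simpa using Matrix.posSemidef_vecMulVec_self_star x) (by simpa using hx)
    have hswap : ∑ u : WordsLE g k, ∑ w : WordsLE g k,
          x u * x w * Λ (wordMonomial (w.1.reverse ++ u.1)) =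
        ∑ u : WordsLE g k, ∑ w : WordsLE g k,
          x u * x w * Λ (wordMonomial (u.1.reverse ++ w.1)) := by
      rw [Finset.sum_comm]
      simp only [mul_comm]
    simp only [gramPoly_apply, map_sum, map_smul, Matrix.vecMulVec_apply, smul_eq_mul] at h
    refine h.trans_eq (Eq.symm ?_)
    calc star x ⬝ᵥ (hankel k L *ᵥ x) = ∑ u : WordsLE g k, ∑ w : WordsLE g k,
          (x u * x w * Λ (wordMonomial (u.1.reverse ++ w.1)) / 2 +
          x u * x w * Λ (wordMonomial (w.1.reverse ++ u.1)) / 2) := by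
          simp only [dotProduct, Matrix.mulVec, hankel, L, Matrix.of_apply, star_trivial,
            Finset.mul_sum, List.reverse_append, List.reverse_reverse]
          refine Finset.sum_congr rfl fun u _ => Finset.sum_congr rfl fun w _ => ?_
          ring
      _ = _ := by
          simp only [Finset.sum_add_distrib, ← Finset.sum_div, hswap]
          ring
  obtain ⟨X, v, R, hX, hR, hM, hw⟩ := exists_wordProd_mulVec_eq hL hpos
  refine ⟨X, v, R, hX, hR, hw, ?_⟩
  have hmoment : ∀ w : List (Fin g), w.length ≤ k → v ⬝ᵥ (wordProd X w *ᵥ v) = L w := by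
    intro w hwk
    have h0 := hw ⟨[], Nat.zero_le k⟩
    rw [wordProd_nil, Matrix.one_mulVec] at h0
    rw [hw ⟨w, hwk⟩, h0, Matrix.dotProduct_mulVec, Matrix.vecMul_mulVec, ← hM]
    simp [hankel]
  have hΛq' : Λ q = (wordCoeff q).sum fun w r => r * Λ (wordMonomial w) := by
    conv_lhs => rw [eq_sum_wordCoeff q]
    simp [Finsupp.sum, map_sum]
  have hrev : (wordCoeff q).sum (fun w r => r * Λ (wordMonomial w.reverse)) = Λ q := by
    conv_rhs => rw [← hsym, eq_sum_wordCoeff q]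
    simp [Finsupp.sum, map_sum, star_smul_real, star_wordMonomial]
  have : v ⬝ᵥ (evalMat q X *ᵥ v) = Λ q := by
    rw [evalMat_eq_sum, Finsupp.sum, Matrix.sum_mulVec, dotProduct_sum]
    simp only [Matrix.smul_mulVec, dotProduct_smul, smul_eq_mul]
    rw [Finset.sum_congr rfl fun w hws => by rw [hmoment w (hk w hws)]]
    simp only [L, mul_div_assoc', mul_add, ← Finset.sum_div, Finset.sum_add_distrib]
    simp only [Finsupp.sum] at hΛq' hrev
    rw [← hΛq', hrev]
    ring
  rw [this]
  exact hΛq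

section Finsler

variable {ι : Type} [Fintype ι]

theorem dotProduct_sq_le (x y : ι → ℝ) : (x ⬝ᵥ y) ^ 2 ≤ (x ⬝ᵥ x) * (y ⬝ᵥ y) := by
  simpa [dotProduct, sq] using Finset.sum_mul_sq_le_sq_mul_sq Finset.univ x y

theorem dotProduct_self_nonneg' (x : ι → ℝ) : 0 ≤ x ⬝ᵥ x :=
  Finset.sum_nonneg fun i _ => mul_self_nonneg (x i)

theorem exists_dotProduct_mulVec_le (S : Matrix ι ι ℝ) :
    ∃ c : ℝ, ∀ y : ι → ℝ, y ⬝ᵥ (S *ᵥ y) ≤ c * (y ⬝ᵥ y) := by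
  refine ⟨(1 + ∑ i, S i ⬝ᵥ S i) / 2, fun y => ?_⟩
  have h1 : (S *ᵥ y) ⬝ᵥ (S *ᵥ y) ≤ (∑ i, S i ⬝ᵥ S i) * (y ⬝ᵥ y) := by
    rw [Finset.sum_mul]
    refine Finset.sum_le_sum fun i _ => ?_
    rw [← sq]
    exact dotProduct_sq_le (S i) y
  have h2 := dotProduct_self_nonneg' (y - S *ᵥ y)
  simp only [sub_dotProduct, dotProduct_sub, dotProduct_comm (S *ᵥ y) y] at h2
  linarith

variable [DecidableEq ι]

/-- A matrix whose quadratic form takes the value `β` at `v` and which is `K` on the orthogonal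
complement of `v`. -/
def pinnedMatrix (v : ι → ℝ) (β K : ℝ) : Matrix ι ι ℝ :=
  (β / (v ⬝ᵥ v) ^ 2) • Matrix.vecMulVec v v + K • (1 - (v ⬝ᵥ v)⁻¹ • Matrix.vecMulVec v v)

theorem pinnedMatrix_isSymm (v : ι → ℝ) (β K : ℝ) : (pinnedMatrix v β K).IsSymm := by
  simp [pinnedMatrix, Matrix.IsSymm, Matrix.transpose_vecMulVec]

theorem dotProduct_pinnedMatrix_mulVec (v : ι → ℝ) (β K : ℝ) (x : ι → ℝ) :
    x ⬝ᵥ (pinnedMatrix v β K *ᵥ x) =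
      β / (v ⬝ᵥ v) ^ 2 * (v ⬝ᵥ x) ^ 2 + K * (x ⬝ᵥ x - (v ⬝ᵥ v)⁻¹ * (v ⬝ᵥ x) ^ 2) := by
  simp only [pinnedMatrix, Matrix.add_mulVec, Matrix.smul_mulVec, Matrix.sub_mulVec,
    Matrix.one_mulVec, Matrix.vecMulVec_mulVec, dotProduct_add, dotProduct_smul, dotProduct_sub,
    smul_eq_mul, op_smul_eq_smul, dotProduct_comm x v]
  ring

theorem dotProduct_pinnedMatrix_mulVec_self {v : ι → ℝ} (hv : v ≠ 0) (β K : ℝ) :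
    v ⬝ᵥ (pinnedMatrix v β K *ᵥ v) = β := by
  have : v ⬝ᵥ v ≠ 0 := fun h => hv (dotProduct_self_eq_zero.mp h)
  rw [dotProduct_pinnedMatrix_mulVec]
  field_simp
  ring

/-- Finsler's lemma. -/
theorem exists_posDef_pinnedMatrix_sub {S : Matrix ι ι ℝ} (hS : S.IsSymm) {v : ι → ℝ} (hv : v ≠ 0)
    {β : ℝ} (hβ : v ⬝ᵥ (S *ᵥ v) < β) :
    ∃ K₀ : ℝ, ∀ K, K₀ ≤ K → (pinnedMatrix v β K - S).PosDef := by
  obtain ⟨c, hc⟩ := exists_dotProduct_mulVec_le S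
  set n := v ⬝ᵥ v with hn
  have hn0 : n ≠ 0 := fun h => hv (dotProduct_self_eq_zero.mp h)
  set s := (S *ᵥ v) ⬝ᵥ (S *ᵥ v) with hs
  set δ := β - v ⬝ᵥ (S *ᵥ v) with hδ
  have hδ0 : 0 < δ := sub_pos.mpr hβ
  refine ⟨c + s / δ + 1, fun K hK => Matrix.PosDef.of_dotProduct_mulVec_pos ?_ fun x hx => ?_⟩
  · rw [Matrix.IsHermitian, Matrix.conjTranspose_eq_transpose_of_trivial, Matrix.transpose_sub,
      hS.eq, (pinnedMatrix_isSymm v β K).eq]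
  obtain ⟨a, ha⟩ : ∃ a, a = (v ⬝ᵥ x) / n := ⟨_, rfl⟩
  obtain ⟨y, hy⟩ : ∃ y, y = x - a • v := ⟨_, rfl⟩
  have hxy : x = a • v + y := by rw [hy]; abel
  have hvx : v ⬝ᵥ x = a * n := by rw [ha]; field_simp
  have hvy : v ⬝ᵥ y = 0 := by
    rw [hy, dotProduct_sub, dotProduct_smul, hvx, smul_eq_mul, sub_self]
  have hxx : x ⬝ᵥ x = a ^ 2 * n + y ⬝ᵥ y := by
    rw [hxy]
    simp only [add_dotProduct, dotProduct_add, smul_dotProduct, dotProduct_smul, smul_eq_mul,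
      dotProduct_comm y v, hvy, ← hn]
    ring
  have hsy : v ⬝ᵥ (S *ᵥ y) = (S *ᵥ v) ⬝ᵥ y := by
    rw [Matrix.dotProduct_mulVec, ← Matrix.mulVec_transpose, hS.eq]
  have hxSx : x ⬝ᵥ (S *ᵥ x) = a ^ 2 * (β - δ) + 2 * a * ((S *ᵥ v) ⬝ᵥ y) + y ⬝ᵥ (S *ᵥ y) := by
    rw [hxy]
    simp only [Matrix.mulVec_add, Matrix.mulVec_smul, add_dotProduct, dotProduct_add,
      smul_dotProduct, dotProduct_smul, smul_eq_mul, hsy, dotProduct_comm y (S *ᵥ v), hδ]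
    ring
  have hz := dotProduct_sq_le (S *ᵥ v) y
  have hcy := hc y
  have hyy := dotProduct_self_nonneg' y
  rw [star_trivial, Matrix.sub_mulVec, dotProduct_sub, dotProduct_pinnedMatrix_mulVec, hvx, hxx,
    hxSx, ← hn]
  rw [← hs] at hz
  generalize (S *ᵥ v) ⬝ᵥ y = z at *
  have hsplit : β / n ^ 2 * (a * n) ^ 2 + K * (a ^ 2 * n + y ⬝ᵥ y - n⁻¹ * (a * n) ^ 2) =
      β * a ^ 2 + K * (y ⬝ᵥ y) := by
    field_simp
    ring
  rw [hsplit]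
  have hKy : (c + s / δ + 1) * (y ⬝ᵥ y) ≤ K * (y ⬝ᵥ y) := mul_le_mul_of_nonneg_right hK hyy
  have hsδ : s / δ * δ = s := div_mul_cancel₀ _ hδ0.ne'
  have hmain : 0 < δ * (δ * a ^ 2 - 2 * a * z + (s / δ + 1) * (y ⬝ᵥ y)) := by
    have : δ * (δ * a ^ 2 - 2 * a * z + (s / δ + 1) * (y ⬝ᵥ y)) =
        (δ * a - z) ^ 2 + (s * (y ⬝ᵥ y) - z ^ 2) + δ * (y ⬝ᵥ y) := by
      linear_combination (y ⬝ᵥ y) * hsδ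
    rw [this]
    rcases hyy.eq_or_lt with h0 | h0
    · rw [← h0, mul_zero] at hz ⊢
      have hz0 : z = 0 := pow_eq_zero_iff two_ne_zero |>.mp (le_antisymm hz (sq_nonneg z))
      have ha0 : a ≠ 0 := by
        rintro rfl
        apply hx
        rw [hxy, dotProduct_self_eq_zero.mp h0.symm]
        simp
      rw [hz0]
      simp only [sub_zero, mul_zero, add_zero]
      have := sq_pos_of_ne_zero (mul_ne_zero hδ0.ne' ha0)
      simpa using this
    · have := mul_pos hδ0 h0
      have := sq_nonneg (δ * a - z)
      linarith
  have := (pos_iff_pos_of_mul_pos hmain).mp hδ0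
  nlinarith

end Finsler

theorem wordProd_submatrix {g : ℕ} {ι κ : Type} [Fintype ι] [DecidableEq ι] [Fintype κ]
    [DecidableEq κ] (e : κ ≃ ι) (X : Fin g → Matrix ι ι ℝ) (w : List (Fin g)) :
    wordProd (fun j => (X j).submatrix e e) w = (wordProd X w).submatrix e e := by
  induction w with
  | nil => simp
  | cons j w ih => simp [ih, Matrix.submatrix_mul_equiv]

theorem evalMat_submatrix {g : ℕ} {ι κ : Type} [Fintype ι] [DecidableEq ι] [Fintype κ]
    [DecidableEq κ] (e : κ ≃ ι) (p : FreeAlgebra ℝ (Fin g)) (X : Fin g → Matrix ι ι ℝ) :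
    evalMat p (fun j => (X j).submatrix e e) = (evalMat p X).submatrix e e := by
  rw [evalMat_eq_sum, evalMat_eq_sum]
  ext i j
  simp [Finsupp.sum, wordProd_submatrix, Matrix.sum_apply]

/-- Scalar form of quasi-convexity: the positive sublevel sets of `X ↦ ⟨q(X)v, v⟩` are midpoint
convex. -/
theorem dotProduct_evalMat_midpoint_lt {g : ℕ} {q : FreeAlgebra ℝ (Fin g)} (hsym : star q = q)
    (hq : ∀ n : ℕ, 0 < n → ∀ A : Matrix (Fin n) (Fin n) ℝ, A.PosDef →
      Convex ℝ {X : Fin g → Matrix (Fin n) (Fin n) ℝ |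
        (∀ j, (X j).IsSymm) ∧ (A - evalMat q X).PosDef})
    {ι : Type} [Fintype ι] [DecidableEq ι] {X Y : Fin g → Matrix ι ι ℝ}
    (hX : ∀ j, (X j).IsSymm) (hY : ∀ j, (Y j).IsSymm) {v : ι → ℝ} {β : ℝ} (hβ : 0 < β)
    (hXv : v ⬝ᵥ (evalMat q X *ᵥ v) < β) (hYv : v ⬝ᵥ (evalMat q Y *ᵥ v) < β) :
    v ⬝ᵥ (evalMat q ((1 / 2 : ℝ) • X + (1 / 2 : ℝ) • Y) *ᵥ v) < β := by
  rcases eq_or_ne v 0 with rfl | hv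
  · simpa using hβ
  obtain ⟨K₁, hK₁⟩ := exists_posDef_pinnedMatrix_sub (evalMat_isSymm hX hsym) hv hXv
  obtain ⟨K₂, hK₂⟩ := exists_posDef_pinnedMatrix_sub (evalMat_isSymm hY hsym) hv hYv
  obtain ⟨K₃, hK₃⟩ := exists_posDef_pinnedMatrix_sub (S := 0) (Matrix.isSymm_zero) hv
    (β := β) (by simpa using hβ)
  set K := max K₁ (max K₂ K₃)
  set A := pinnedMatrix v β K with hA
  have h₁ := hK₁ K (le_max_left _ _)
  have h₂ := hK₂ K ((le_max_left _ _).trans (le_max_right _ _))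
  have h₃ := hK₃ K ((le_max_right _ _).trans (le_max_right _ _))
  rw [sub_zero] at h₃
  let e := (Fintype.equivFin ι).symm
  have hn : 0 < Fintype.card ι := by
    obtain ⟨i, -⟩ := Function.ne_iff.mp hv
    exact Fintype.card_pos_iff.mpr ⟨i⟩
  have hconv := hq _ hn (A.submatrix e e) (h₃.submatrix e.injective)
  have hmem : ∀ Z : Fin g → Matrix ι ι ℝ, (∀ j, (Z j).IsSymm) → (A - evalMat q Z).PosDef →
      (fun j => (Z j).submatrix e e) ∈ {X : Fin g → Matrix (Fin (Fintype.card ι)) _ ℝ |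
        (∀ j, (X j).IsSymm) ∧ (A.submatrix e e - evalMat q X).PosDef} := by
    intro Z hZ hpos
    refine ⟨fun j => (hZ j).submatrix e, ?_⟩
    rw [evalMat_submatrix]
    exact hpos.submatrix e.injective
  have hmid := (hconv (hmem X hX h₁) (hmem Y hY h₂) (by norm_num : (0 : ℝ) ≤ 1 / 2)
    (by norm_num : (0 : ℝ) ≤ 1 / 2) (by norm_num)).2
  have heq : (1 / 2 : ℝ) • (fun j => (X j).submatrix e e) +
      (1 / 2 : ℝ) • (fun j => (Y j).submatrix e e) =
      fun j => (((1 / 2 : ℝ) • X + (1 / 2 : ℝ) • Y) j).submatrix e e := rfl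
  rw [heq, evalMat_submatrix] at hmid
  have hmid' := Matrix.PosDef.submatrix (M := (A - evalMat q ((1 / 2 : ℝ) • X + (1 / 2 : ℝ) • Y)
    ).submatrix e e) hmid e.symm.injective
  rw [Matrix.submatrix_submatrix, Equiv.self_comp_symm, Matrix.submatrix_id_id] at hmid'
  have := hmid'.dotProduct_mulVec_pos hv
  rw [star_trivial, Matrix.sub_mulVec, dotProduct_sub,
    dotProduct_pinnedMatrix_mulVec_self hv] at this
  linarith

section Bordered

variable {g : ℕ} {ι : Type}

/-- The tuple `X` bordered by the vectors `t • α j`. -/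
def bordered (X : Fin g → Matrix ι ι ℝ) (α : Fin g → ι → ℝ) (t : ℝ) :
    Fin g → Matrix (ι ⊕ Unit) (ι ⊕ Unit) ℝ := fun j =>
  Matrix.fromBlocks (X j) (Matrix.of fun i _ => t * α j i) (Matrix.of fun _ i => t * α j i) 0

theorem bordered_isSymm {X : Fin g → Matrix ι ι ℝ} (hX : ∀ j, (X j).IsSymm) (α : Fin g → ι → ℝ)
    (t : ℝ) (j : Fin g) : (bordered X α t j).IsSymm :=
  Matrix.IsSymm.fromBlocks (hX j) rfl Matrix.isSymm_zero

theorem bordered_mulVec [Fintype ι] (X : Fin g → Matrix ι ι ℝ) (α : Fin g → ι → ℝ) (t : ℝ)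
    (j : Fin g) (a : ι → ℝ) (b : ℝ) :
    bordered X α t j *ᵥ Sum.elim a (fun _ => b) =
      Sum.elim (X j *ᵥ a + (t * b) • α j) (fun _ => t * (α j ⬝ᵥ a)) := by
  rw [bordered, Matrix.fromBlocks_mulVec]
  congr 1
  · ext i
    simp [Matrix.mulVec, dotProduct]
    ring
  · ext i
    simp [Matrix.mulVec, dotProduct, Finset.mul_sum, mul_assoc]

variable [Fintype ι] [DecidableEq ι]

/-- First-order coefficient of `wordProd (bordered X α t) w` applied to `v`. -/
def borderCoeff (X : Fin g → Matrix ι ι ℝ) (α : Fin g → ι → ℝ) (v : ι → ℝ) :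
    List (Fin g) → ℝ
  | [] => 0
  | j :: w => α j ⬝ᵥ (wordProd X w *ᵥ v)

/-- Second-order coefficient of `wordProd (bordered X α t) w` applied to `v`. -/
def borderHess (X : Fin g → Matrix ι ι ℝ) (α : Fin g → ι → ℝ) (v : ι → ℝ) :
    List (Fin g) → ι → ℝ
  | [] => 0
  | j :: w => X j *ᵥ borderHess X α v w + borderCoeff X α v w • α j

theorem exists_wordProd_bordered_mulVec (X : Fin g → Matrix ι ι ℝ) (α : Fin g → ι → ℝ)
    (v : ι → ℝ) (w : List (Fin g)) :
    ∃ (A : ℝ → ι → ℝ) (B : ℝ → ℝ), Continuous A ∧ Continuous B ∧ ∀ t,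
      wordProd (bordered X α t) w *ᵥ Sum.elim v (fun _ => 0) =
        Sum.elim (wordProd X w *ᵥ v + t ^ 2 • (borderHess X α v w + t ^ 2 • A (t ^ 2)))
          (fun _ => t * (borderCoeff X α v w + t ^ 2 * B (t ^ 2))) := by
  induction w with
  | nil =>
    exact ⟨0, 0, continuous_const, continuous_const, fun t => by simp [borderHess, borderCoeff]⟩
  | cons j w ih =>
    obtain ⟨A, B, hA, hB, h⟩ := ih
    refine ⟨fun s => X j *ᵥ A s + B s • α j, fun s => α j ⬝ᵥ (borderHess X α v w + s • A s),
      ?_, ?_, fun t => ?_⟩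
    · exact (Continuous.matrix_mulVec continuous_const hA).add (by fun_prop)
    · fun_prop
    · rw [wordProd_cons, ← Matrix.mulVec_mulVec, h, bordered_mulVec]
      congr 1
      · simp only [wordProd_cons, ← Matrix.mulVec_mulVec, Matrix.mulVec_add, Matrix.mulVec_smul,
          borderHess, smul_add, smul_smul]
        module
      · ext
        simp only [borderCoeff, dotProduct_add, dotProduct_smul, smul_eq_mul]

/-- Sum, over all ways of splitting a word `w = a ++ c` with `a` nonempty, of
`ψ (a.reverse ++ a₀) * ψ c`. -/
def splitSum (ψ : List (Fin g) → ℝ) (a₀ w : List (Fin g)) : ℝ :=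
  ∑ i ∈ Finset.range w.length, ψ ((w.take (i + 1)).reverse ++ a₀) * ψ (w.drop (i + 1))

theorem dotProduct_borderHess {X : Fin g → Matrix ι ι ℝ} (hX : ∀ j, (X j).IsSymm)
    (α : Fin g → ι → ℝ) (v : ι → ℝ) (a w : List (Fin g)) :
    (wordProd X a *ᵥ v) ⬝ᵥ borderHess X α v w = splitSum (borderCoeff X α v) a w := by
  induction w generalizing a with
  | nil => simp [borderHess, splitSum]
  | cons j w ih =>
    have h1 : (wordProd X a *ᵥ v) ⬝ᵥ (X j *ᵥ borderHess X α v w) =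
        (wordProd X (j :: a) *ᵥ v) ⬝ᵥ borderHess X α v w := by
      rw [Matrix.dotProduct_mulVec, ← Matrix.mulVec_transpose, (hX j).eq, wordProd_cons,
        Matrix.mulVec_mulVec]
    rw [borderHess, dotProduct_add, h1, ih, dotProduct_smul, splitSum, splitSum,
      List.length_cons, Finset.sum_range_succ']
    simp only [List.take_succ_cons, List.reverse_cons, List.append_assoc, List.singleton_append,
      List.drop_succ_cons, List.take_zero, List.reverse_nil, List.nil_append, List.drop_zero,
      smul_eq_mul]
    rw [dotProduct_comm, mul_comm (borderCoeff X α v w)]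
    rfl

/-- Second-order necessary condition for quasi-convexity at a point with positive value. -/
theorem sum_splitSum_nonneg {q : FreeAlgebra ℝ (Fin g)} (hsym : star q = q)
    (hq : ∀ n : ℕ, 0 < n → ∀ A : Matrix (Fin n) (Fin n) ℝ, A.PosDef →
      Convex ℝ {X : Fin g → Matrix (Fin n) (Fin n) ℝ |
        (∀ j, (X j).IsSymm) ∧ (A - evalMat q X).PosDef})
    {X : Fin g → Matrix ι ι ℝ} (hX : ∀ j, (X j).IsSymm) {v : ι → ℝ}
    (hv : 0 < v ⬝ᵥ (evalMat q X *ᵥ v)) (α : Fin g → ι → ℝ) :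
    0 ≤ (wordCoeff q).sum fun w r => r * splitSum (borderCoeff X α v) [] w := by
  choose A B hA hB h using exists_wordProd_bordered_mulVec X α v
  set H := (wordCoeff q).sum fun w r => r * splitSum (borderCoeff X α v) [] w with hH
  let v' : ι ⊕ Unit → ℝ := Sum.elim v fun _ => 0
  let ρ : ℝ → ℝ := fun s => (wordCoeff q).sum fun w r => r * (v ⬝ᵥ A w s)
  have hρ : Continuous ρ := continuous_finsetSum _ fun w _ => by fun_prop
  have hexp : ∀ t : ℝ, v' ⬝ᵥ (evalMat q (bordered X α t) *ᵥ v') =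
      v ⬝ᵥ (evalMat q X *ᵥ v) + t ^ 2 * (H + t ^ 2 * ρ (t ^ 2)) := by
    intro t
    simp only [evalMat_eq_sum, Finsupp.sum, Matrix.sum_mulVec, dotProduct_sum, hH, ρ,
      Finset.mul_sum, ← Finset.sum_add_distrib]
    refine Finset.sum_congr rfl fun w _ => ?_
    rw [Matrix.smul_mulVec, Matrix.smul_mulVec, h, ← dotProduct_borderHess hX, wordProd_nil,
      Matrix.one_mulVec]
    simp only [v', dotProduct_smul, _root_.sumElim_dotProduct_sumElim, dotProduct_add, smul_eq_mul,
      show ∀ z : Unit → ℝ, (fun _ : Unit => (0 : ℝ)) ⬝ᵥ z = 0 from fun z => zero_dotProduct z]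
    ring
  have hmid : ∀ t : ℝ, (1 / 2 : ℝ) • bordered X α t + (1 / 2 : ℝ) • bordered X α (-t) =
      bordered X α 0 := by
    intro t
    ext j (a | a) (b | b) <;> simp [bordered]
    all_goals ring
  have hnn : ∀ t : ℝ, t ≠ 0 → 0 ≤ H + t ^ 2 * ρ (t ^ 2) := by
    intro t ht
    by_contra! hneg
    have h2 := mul_neg_of_pos_of_neg (sq_pos_of_ne_zero ht) hneg
    have h3 := dotProduct_evalMat_midpoint_lt hsym hq (bordered_isSymm hX α t)
      (bordered_isSymm hX α (-t)) (v := v') hv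
      (by rw [hexp]; linarith) (by rw [hexp, neg_sq]; linarith)
    rw [hmid, hexp] at h3
    simp at h3
  have hlim : Filter.Tendsto (fun t : ℝ => H + t ^ 2 * ρ (t ^ 2)) (nhdsWithin 0 {0}ᶜ) (nhds H) := by
    have hc : Continuous fun t : ℝ => H + t ^ 2 * ρ (t ^ 2) := by fun_prop
    have := hc.tendsto 0
    simp only [ne_eq, OfNat.ofNat_ne_zero, not_false_eq_true, zero_pow, zero_mul, add_zero] at this
    exact this.mono_left nhdsWithin_le_nhds
  exact ge_of_tendsto hlim (Filter.eventually_of_mem self_mem_nhdsWithin hnn)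

end Bordered

section Core

variable {g : ℕ}

theorem splitSum_congr {φ ψ : List (Fin g) → ℝ} {k : ℕ}
    (h : ∀ w : List (Fin g), w.length ≤ k → φ w = ψ w) {w : List (Fin g)} (hw : w.length ≤ k) :
    splitSum φ [] w = splitSum ψ [] w := by
  refine Finset.sum_congr rfl fun i _ => ?_
  rw [h _ (by simp; omega), h _ (by simp; omega)]

theorem splitSum_nil_eq (h : List (Fin g) →₀ ℝ) (h0 : h [] = 0) (w : List (Fin g)) :
    splitSum h [] w = h.sum fun a r => h.sum fun c s =>
      if a.reverse ++ c = w then r * s else 0 := by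
  have key : ∀ a c : List (Fin g), a ≠ [] →
      (if a.reverse ++ c = w then h a * h c else 0) = ∑ i ∈ Finset.range w.length,
        if a = (w.take (i + 1)).reverse ∧ c = w.drop (i + 1) then h a * h c else 0 := by
    intro a c ha
    have hpos : 0 < a.length := List.length_pos_iff.mpr ha
    split_ifs with hw
    · rw [Finset.sum_eq_single (a.length - 1)]
      · rw [if_pos]
        rw [Nat.sub_add_cancel hpos, ← hw]
        simp
      · rintro i hi hne
        rw [if_neg]
        rintro ⟨h1, -⟩
        have := congrArg List.length h1
        simp only [List.length_reverse, List.length_take] at this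
        have := Finset.mem_range.1 hi
        omega
      · intro hi
        exfalso
        apply hi
        rw [Finset.mem_range, ← hw]
        simp
        omega
    · refine (Finset.sum_eq_zero fun i _ => if_neg ?_).symm
      rintro ⟨rfl, rfl⟩
      simp at hw
  have hne : ∀ a ∈ h.support, a ≠ [] := by
    rintro a ha rfl
    exact Finsupp.mem_support_iff.1 ha h0
  simp only [Finsupp.sum, splitSum, List.append_nil]
  rw [Finset.sum_congr rfl fun a ha => Finset.sum_congr rfl fun c _ => key a c (hne a ha)]
  simp_rw [Finset.sum_comm (t := Finset.range w.length)]
  refine Finset.sum_congr rfl fun i _ => ?_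
  simp only [ite_and]
  by_cases h1 : h (w.take (i + 1)).reverse = 0 <;> by_cases h2 : h (w.drop (i + 1)) = 0 <;>
    simp [Finset.sum_ite_irrel, h1, h2]

variable {q : FreeAlgebra ℝ (Fin g)}

theorem sum_splitSum_nonneg_of_apply_nil_eq_zero (hsym : star q = q)
    (hq : ∀ n : ℕ, 0 < n → ∀ A : Matrix (Fin n) (Fin n) ℝ, A.PosDef →
      Convex ℝ {X : Fin g → Matrix (Fin n) (Fin n) ℝ |
        (∀ j, (X j).IsSymm) ∧ (A - evalMat q X).PosDef})
    (hneg : ¬ IsHermitianSOS (-q)) (h : List (Fin g) → ℝ) (h0 : h [] = 0) :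
    0 ≤ (wordCoeff q).sum fun w r => r * splitSum h [] w := by
  let k := (wordCoeff q).support.sup List.length
  have hk : ∀ w ∈ (wordCoeff q).support, w.length ≤ k := fun w hw => Finset.le_sup hw
  obtain ⟨X, v, R, hX, hR, hXv, hv⟩ := exists_pos_evalMat hsym hneg hk
  let α : Fin g → WordsLE g k → ℝ := fun j => (R⁻¹)ᵀ *ᵥ fun c => h (j :: c.1)
  have hα : ∀ w : List (Fin g), w.length ≤ k → borderCoeff X α v w = h w := by
    rintro (_ | ⟨j, w⟩) hw
    · exact h0.symm
    · have hw' : w.length ≤ k := by simp at hw; omega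
      have := hXv ⟨w, hw'⟩
      simp only at this
      simp only [α]
      rw [borderCoeff, this, Matrix.dotProduct_mulVec, Matrix.mulVec_transpose,
        Matrix.vecMul_vecMul, Matrix.nonsing_inv_mul _ ((Matrix.isUnit_iff_isUnit_det R).1 hR),
        Matrix.vecMul_one, dotProduct_single, mul_one]
  have := sum_splitSum_nonneg hsym hq hX hv α
  rwa [Finsupp.sum_congr (g2 := fun w r => r * splitSum h [] w) fun w hw => by
    rw [splitSum_congr hα (hk w hw)]] at this

/-- The quadratic form of the middle matrix of `q` is nonnegative. -/
theorem sum_wordCoeff_nonneg (hsym : star q = q)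
    (hq : ∀ n : ℕ, 0 < n → ∀ A : Matrix (Fin n) (Fin n) ℝ, A.PosDef →
      Convex ℝ {X : Fin g → Matrix (Fin n) (Fin n) ℝ |
        (∀ j, (X j).IsSymm) ∧ (A - evalMat q X).PosDef})
    (hneg : ¬ IsHermitianSOS (-q)) (h : List (Fin g) →₀ ℝ) (h0 : h [] = 0) :
    0 ≤ h.sum fun a r => h.sum fun c s => r * s * wordCoeff q (a.reverse ++ c) := by
  have := sum_splitSum_nonneg_of_apply_nil_eq_zero hsym hq hneg h h0
  convert this using 1
  simp only [splitSum_nil_eq h h0, Finsupp.sum, Finset.mul_sum]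
  rw [Finset.sum_comm (s := (wordCoeff q).support)]
  refine Finset.sum_congr rfl fun a _ => ?_
  rw [Finset.sum_comm (s := (wordCoeff q).support)]
  refine Finset.sum_congr rfl fun c _ => ?_
  by_cases hz : wordCoeff q (a.reverse ++ c) = 0 <;> simp [hz, mul_comm]

theorem wordCoeff_eq_zero_of_three_le_length (hsym : star q = q)
    (hq : ∀ n : ℕ, 0 < n → ∀ A : Matrix (Fin n) (Fin n) ℝ, A.PosDef →
      Convex ℝ {X : Fin g → Matrix (Fin n) (Fin n) ℝ |
        (∀ j, (X j).IsSymm) ∧ (A - evalMat q X).PosDef})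
    (hneg : ¬ IsHermitianSOS (-q)) {w : List (Fin g)} (hw : 3 ≤ w.length) :
    wordCoeff q w = 0 := by
  by_contra hne
  obtain ⟨u, hu, hmax⟩ := (wordCoeff q).support.exists_max_image List.length
    ⟨w, Finsupp.mem_support_iff.2 hne⟩
  have hwu := hmax w (Finsupp.mem_support_iff.2 hne)
  have hu0 := Finsupp.mem_support_iff.1 hu
  obtain _ | ⟨i, c⟩ := u
  · rw [List.length_nil] at hwu
    omega
  have hc : 2 ≤ c.length := by rw [List.length_cons] at hwu; omega
  have hcc : wordCoeff q (c.reverse ++ c) = 0 := by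
    by_contra h
    have := hmax _ (Finsupp.mem_support_iff.2 h)
    simp at this
    omega
  have hci : wordCoeff q (c.reverse ++ [i]) = wordCoeff q (i :: c) := by
    have := wordCoeff_star q (i :: c)
    rw [hsym, List.reverse_cons] at this
    exact this.symm
  have hform : ∀ s : ℝ, 0 ≤ wordCoeff q [i, i] + 2 * s * wordCoeff q (i :: c) := by
    intro s
    have hc0 : c ≠ [] := by rintro rfl; simp at hc
    have := sum_wordCoeff_nonneg hsym hq hneg (Finsupp.single [i] 1 + Finsupp.single c s)
      (by simp [hc0])
    rw [Finsupp.sum_add_index' (by simp) (by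
        intro a r r'
        simp only [add_mul, Finsupp.sum_add])] at this
    rw [Finsupp.sum_single_index (by simp), Finsupp.sum_single_index (by simp),
      Finsupp.sum_add_index' (by simp) (by intros; ring),
      Finsupp.sum_add_index' (by simp) (by intros; ring)] at this
    simp only [Finsupp.sum_single_index, mul_zero, zero_mul, List.reverse_singleton,
      List.singleton_append, hcc, hci] at this
    linarith
  have := hform (-(wordCoeff q [i, i] + 1) / (2 * wordCoeff q (i :: c)))
  have h2 : 2 * (-(wordCoeff q [i, i] + 1) / (2 * wordCoeff q (i :: c))) * wordCoeff q (i :: c) =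
      -(wordCoeff q [i, i] + 1) := by
    field_simp
  linarith

theorem posSemidef_wordCoeff_pair (hsym : star q = q)
    (hq : ∀ n : ℕ, 0 < n → ∀ A : Matrix (Fin n) (Fin n) ℝ, A.PosDef →
      Convex ℝ {X : Fin g → Matrix (Fin n) (Fin n) ℝ |
        (∀ j, (X j).IsSymm) ∧ (A - evalMat q X).PosDef})
    (hneg : ¬ IsHermitianSOS (-q)) :
    (Matrix.of fun i j : Fin g => wordCoeff q [i, j]).PosSemidef := by
  refine Matrix.PosSemidef.of_dotProduct_mulVec_nonneg ?_ fun x => ?_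
  · ext i j
    have := wordCoeff_star q [i, j]
    rw [hsym] at this
    simpa using this.symm
  · have := sum_wordCoeff_nonneg hsym hq hneg (∑ j, Finsupp.single [j] (x j)) (by simp)
    rw [← Finsupp.sum_finsetSum_index (by simp) (by
        intro a r r'
        simp only [add_mul, Finsupp.sum_add])] at this
    refine le_of_le_of_eq this (Eq.symm ?_)
    rw [dotProduct]
    refine Finset.sum_congr rfl fun i _ => ?_
    rw [Matrix.mulVec, dotProduct, Finset.mul_sum, Finsupp.sum_single_index (by simp),
      ← Finsupp.sum_finsetSum_index (by simp) (by intros; ring)]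
    refine Finset.sum_congr rfl fun j _ => ?_
    rw [Finsupp.sum_single_index (by simp)]
    simp
    ring

theorem cond1_of_convex (hsym : star q = q)
    (hq : ∀ n : ℕ, 0 < n → ∀ A : Matrix (Fin n) (Fin n) ℝ, A.PosDef →
      Convex ℝ {X : Fin g → Matrix (Fin n) (Fin n) ℝ |
        (∀ j, (X j).IsSymm) ∧ (A - evalMat q X).PosDef})
    (hneg : ¬ IsHermitianSOS (-q)) : Cond1 g q := by
  obtain ⟨B, hB⟩ := (posSemidef_wordCoeff_pair hsym hq hneg).exists_eq_transpose_mul_self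
  have hι : ∀ j : Fin g, FreeAlgebra.ι ℝ j ∈ degOne g := fun j => Submodule.subset_span ⟨j, rfl⟩
  refine ⟨∑ j, wordCoeff q [j] • FreeAlgebra.ι ℝ j, g, fun m => ∑ j, B m j • FreeAlgebra.ι ℝ j,
    Submodule.sum_mem _ fun j _ => Submodule.smul_mem _ _ (hι j),
    fun m => Submodule.sum_mem _ fun j _ => Submodule.smul_mem _ _ (hι j), ?_⟩
  have hword : ∀ j : Fin g, FreeAlgebra.ι ℝ j = wordMonomial [j] := fun j => by
    simp [wordMonomial]
  have hsq : ∑ m, star (∑ j, B m j • FreeAlgebra.ι ℝ j) * ∑ j, B m j • FreeAlgebra.ι ℝ j =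
      ∑ i, ∑ j, wordCoeff q [i, j] • wordMonomial [i, j] := by
    have hQ : ∀ i j, wordCoeff q [i, j] = ∑ m, B m i * B m j := fun i j => by
      simpa [Matrix.mul_apply] using congrFun (congrFun hB i) j
    simp only [star_sum, star_smul_real, hword, star_wordMonomial, List.reverse_singleton,
      Finset.sum_mul_sum, smul_mul_smul_comm, ← wordMonomial_append, List.singleton_append, hQ,
      Finset.sum_smul]
    rw [Finset.sum_comm]
    exact Finset.sum_congr rfl fun i _ => Finset.sum_comm
  rw [hsq, sub_eq_iff_eq_add, algebraMap_eq_smul_wordMonomial, constantTerm_eq_wordCoeff]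
  apply wordCoeff.injective
  ext w
  simp only [map_add, map_sum, map_smul, hword, wordCoeff_wordMonomial, Finsupp.add_apply,
    Finsupp.finsetSum_apply, Finsupp.smul_apply, Finsupp.single_apply, smul_eq_mul]
  match w with
  | [] => simp
  | [a] => simp
  | [a, b] =>
    simp [ite_and]
  | a :: b :: c :: w =>
    rw [wordCoeff_eq_zero_of_three_le_length hsym hq hneg (by simp)]
    simp

end Core

section Implications

variable {g : ℕ} {p : FreeAlgebra ℝ (Fin g)}

theorem evalMat_linear_of_mem_degOne {ι : Type} [Fintype ι] [DecidableEq ι]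
    {s : FreeAlgebra ℝ (Fin g)} (hs : s ∈ degOne g) (X Y : Fin g → Matrix ι ι ℝ) (a b : ℝ) :
    evalMat s (a • X + b • Y) = a • evalMat s X + b • evalMat s Y := by
  induction hs using Submodule.span_induction with
  | mem x hx =>
    obtain ⟨j, rfl⟩ := hx
    simp [evalMat]
  | zero => simp [evalMat]
  | add x y _ _ hx hy =>
    simp only [evalMat, map_add] at hx hy ⊢
    rw [hx, hy]
    module
  | smul r x _ hx =>
    simp only [evalMat, map_smul] at hx ⊢
    rw [hx]
    module

theorem evalMat_neg_of_mem_degOne {ι : Type} [Fintype ι] [DecidableEq ι]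
    {s : FreeAlgebra ℝ (Fin g)} (hs : s ∈ degOne g) (X : Fin g → Matrix ι ι ℝ) :
    evalMat s (-X) = -evalMat s X := by
  simpa using evalMat_linear_of_mem_degOne hs X 0 (-1) 0

theorem eq_zero_of_mem_degOne {s : FreeAlgebra ℝ (Fin g)} (hs : s ∈ degOne g)
    (h : ∀ X : Fin g → Matrix (Fin 1) (Fin 1) ℝ, (∀ j, (X j).IsSymm) → evalMat s X 0 0 = 0) :
    s = 0 := by
  obtain ⟨c, rfl⟩ := (Submodule.mem_span_range_iff_exists_fun ℝ).1 hs
  refine Finset.sum_eq_zero fun i _ => ?_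
  have := h (fun j => Matrix.of fun _ _ => if j = i then 1 else 0) fun j => rfl
  have hc : c i = 0 := by
    simpa [evalMat, Matrix.sum_apply] using this
  rw [hc, zero_smul]

theorem evalMat_algebraMap {ι : Type} [Fintype ι] [DecidableEq ι] (c : ℝ)
    (X : Fin g → Matrix ι ι ℝ) :
    evalMat (algebraMap ℝ (FreeAlgebra ℝ (Fin g)) c) X = c • 1 := by
  rw [evalMat, AlgHom.commutes, Algebra.algebraMap_eq_smul_one]

theorem evalMat_sum_star_mul {ι : Type} [Fintype ι] [DecidableEq ι] {m : ℕ}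
    (s : Fin m → FreeAlgebra ℝ (Fin g)) {X : Fin g → Matrix ι ι ℝ} (hX : ∀ j, (X j).IsSymm) :
    evalMat (∑ j, star (s j) * s j) X = ∑ j, (evalMat (s j) X)ᵀ * evalMat (s j) X := by
  simp only [← evalMat_star hX]
  simp [evalMat]

theorem Matrix.posSemidef_sum_transpose_mul_self {ι : Type} [Fintype ι] {m : ℕ}
    (M : Fin m → Matrix ι ι ℝ) : (∑ j, (M j)ᵀ * M j).PosSemidef :=
  Matrix.posSemidef_sum _ fun j _ => by
    simpa using Matrix.posSemidef_conjTranspose_mul_self (M j)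

theorem Cond1.cond2 (h : Cond1 g p) : Cond2 g p := by
  obtain ⟨l, m, s, hl, hs, hp⟩ := h
  intro n _ X Y hX hY t ht0 ht1
  have hsymm : ∀ j, ((t • X + (1 - t) • Y) j).IsSymm := fun j =>
    ((hX j).smul t).add ((hY j).smul (1 - t))
  have hev : ∀ Z : Fin g → Matrix (Fin n) (Fin n) ℝ, (∀ j, (Z j).IsSymm) → evalMat p Z =
      constantTerm p • 1 + evalMat l Z + ∑ j, (evalMat (s j) Z)ᵀ * evalMat (s j) Z := by
    intro Z hZ
    rw [← evalMat_sum_star_mul s hZ, ← evalMat_algebraMap _ Z, add_assoc, add_comm,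
      ← sub_eq_iff_eq_add]
    simp only [evalMat, ← map_sub, ← map_add, hp]
  have hgap : t • evalMat p X + (1 - t) • evalMat p Y - evalMat p (t • X + (1 - t) • Y) =
      (t * (1 - t)) • ∑ j, (evalMat (s j) X - evalMat (s j) Y)ᵀ *
        (evalMat (s j) X - evalMat (s j) Y) := by
    rw [hev X hX, hev Y hY, hev _ hsymm, evalMat_linear_of_mem_degOne hl]
    simp only [evalMat_linear_of_mem_degOne (hs _), Matrix.transpose_add, Matrix.transpose_smul,
      Matrix.transpose_sub, add_mul, mul_add, sub_mul, mul_sub, smul_mul_assoc, mul_smul_comm,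
      Finset.sum_add_distrib, Finset.sum_sub_distrib, ← Finset.smul_sum]
    module
  change (t • evalMat p X + (1 - t) • evalMat p Y -
    evalMat p (t • X + (1 - t) • Y)).PosSemidef
  rw [hgap]
  exact (Matrix.posSemidef_sum_transpose_mul_self _).smul (mul_nonneg ht0 (sub_nonneg.2 ht1))

theorem Cond2.cond3 (h : Cond2 g p) : Cond3 g p := by
  rintro n hn A - X ⟨hX, hAX⟩ Y ⟨hY, hAY⟩ a b ha hb hab
  obtain rfl : b = 1 - a := by linarith
  refine ⟨fun j => ((hX j).smul a).add ((hY j).smul (1 - a)), ?_⟩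
  have hgap := h n hn X Y hX hY a ha (by linarith)
  have hcomb : (a • (A - evalMat p X) + (1 - a) • (A - evalMat p Y)).PosDef := by
    rcases ha.eq_or_lt with rfl | ha'
    · simpa using hAY
    · exact (hAX.smul ha').add_posSemidef (hAY.posSemidef.smul hb)
  convert hcomb.add_posSemidef hgap using 1
  change A - evalMat p (fun j => a • X j + (1 - a) • Y j) = _
  module

theorem constantTerm_star (p : FreeAlgebra ℝ (Fin g)) :
    constantTerm (star p) = constantTerm p := by
  rw [constantTerm_eq_wordCoeff, wordCoeff_star, List.reverse_nil, ← constantTerm_eq_wordCoeff]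

theorem IsHermitianSOS.constantTerm_nonneg (h : IsHermitianSOS p) : 0 ≤ constantTerm p := by
  obtain ⟨m, h, rfl⟩ := h
  have : constantTerm (∑ j, star (h j) * h j) =
      ∑ j, constantTerm (star (h j)) * constantTerm (h j) := by
    simp [constantTerm]
  rw [this]
  exact Finset.sum_nonneg fun j _ => by
    rw [constantTerm_star]
    exact mul_self_nonneg _

theorem constantTerm_add_algebraMap (p : FreeAlgebra ℝ (Fin g)) (c : ℝ) :
    constantTerm (p + algebraMap ℝ _ c) = constantTerm p + c := by
  simp [constantTerm]

theorem Cond3.convex_add_algebraMap (h : Cond3 g p) (c : ℝ) {n : ℕ} (hn : 0 < n)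
    {A : Matrix (Fin n) (Fin n) ℝ} (hA : A.PosDef) :
    Convex ℝ {X : Fin g → Matrix (Fin n) (Fin n) ℝ |
      (∀ j, (X j).IsSymm) ∧ (A - evalMat (p + algebraMap ℝ _ c) X).PosDef} := by
  have := h n hn (A - c • 1) (by
    have hAs : A.IsSymm := by simpa [Matrix.IsSymm] using hA.isHermitian.eq
    exact hAs.sub (Matrix.isSymm_one.smul c))
  convert this using 5
  rw [evalMat, map_add, ← evalMat, ← evalMat, evalMat_algebraMap]
  abel

theorem Cond1.of_add_algebraMap {c : ℝ} (h : Cond1 g (p + algebraMap ℝ _ c)) : Cond1 g p := by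
  obtain ⟨l, m, s, hl, hs, hp⟩ := h
  refine ⟨l, m, s, hl, hs, ?_⟩
  rw [← hp, constantTerm_add_algebraMap, map_add]
  abel

theorem star_add_algebraMap (hsym : star p = p) (c : ℝ) :
    star (p + algebraMap ℝ _ c) = p + algebraMap ℝ _ c := by
  rw [star_add, hsym, FreeAlgebra.star_algebraMap]

theorem Cond3.cond1 (hsym : star p = p) (h : Cond3 g p) : Cond1 g p := by
  refine Cond1.of_add_algebraMap (c := 1 - constantTerm p)
    (cond1_of_convex (star_add_algebraMap hsym _)
      (fun n hn A hA => h.convex_add_algebraMap _ hn hA) fun hSOS => ?_)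
  have h0 := hSOS.constantTerm_nonneg
  have h1 := constantTerm_add_algebraMap p (1 - constantTerm p)
  have h2 : ∀ r : FreeAlgebra ℝ (Fin g), constantTerm (-r) = -constantTerm r := fun r => by
    simp [constantTerm]
  rw [h2, h1] at h0
  linarith

theorem Cond1.eq_zero_of_isHermitianSOS (h : Cond1 g p)
    (hSOS : IsHermitianSOS (algebraMap ℝ (FreeAlgebra ℝ (Fin g)) (constantTerm p) - p)) :
    algebraMap ℝ (FreeAlgebra ℝ (Fin g)) (constantTerm p) - p = 0 := by
  obtain ⟨l, m, s, hl, hs, hp⟩ := h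
  obtain ⟨k, f, hf⟩ := hSOS
  have hsum : -(l + ∑ j, star (s j) * s j) = ∑ j, star (f j) * f j := by rw [← hp, ← hf, neg_sub]
  have hle : ∀ X : Fin g → Matrix (Fin 1) (Fin 1) ℝ, (∀ j, (X j).IsSymm) →
      evalMat l X 0 0 + ∑ j, (evalMat (s j) X 0 0) ^ 2 ≤ 0 := by
    intro X hX
    have h1 : evalMat (-(l + ∑ j, star (s j) * s j)) X 0 0 =
        -(evalMat l X 0 0 + ∑ j, (evalMat (s j) X 0 0) ^ 2) := by
      have : evalMat (-(l + ∑ j, star (s j) * s j)) X =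
          -(evalMat l X + evalMat (∑ j, star (s j) * s j) X) := by
        simp only [evalMat, map_neg, map_add]
      rw [this, evalMat_sum_star_mul s hX]
      simp [Matrix.sum_apply, Matrix.mul_apply, sq]
    rw [hsum, evalMat_sum_star_mul f hX] at h1
    have := (Matrix.posSemidef_sum_transpose_mul_self fun j => evalMat (f j) X).diag_nonneg
      (i := 0)
    linarith
  have hle' : ∀ X : Fin g → Matrix (Fin 1) (Fin 1) ℝ, (∀ j, (X j).IsSymm) →
      -evalMat l X 0 0 + ∑ j, (evalMat (s j) X 0 0) ^ 2 ≤ 0 := by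
    intro X hX
    simpa [evalMat_neg_of_mem_degOne hl, evalMat_neg_of_mem_degOne (hs _)] using
      hle (-X) fun j => (hX j).neg
  have hnn : ∀ X : Fin g → Matrix (Fin 1) (Fin 1) ℝ, 0 ≤ ∑ j, (evalMat (s j) X 0 0) ^ 2 :=
    fun X => Finset.sum_nonneg fun j _ => sq_nonneg _
  have hl0 : l = 0 := eq_zero_of_mem_degOne hl fun X hX => by
    linarith [hle X hX, hle' X hX, hnn X]
  have hs0 : ∀ j, s j = 0 := fun j => eq_zero_of_mem_degOne (hs j) fun X hX => by
    have h0 : ∑ j, (evalMat (s j) X 0 0) ^ 2 = 0 := by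
      linarith [hle X hX, hle' X hX, hnn X]
    exact pow_eq_zero_iff two_ne_zero |>.1
      ((Finset.sum_eq_zero_iff_of_nonneg fun j _ => sq_nonneg _).1 h0 j (Finset.mem_univ j))
  rw [← neg_sub, hp, hl0]
  simp [hs0]

theorem sub_algebraMap_eq (p : FreeAlgebra ℝ (Fin g)) (c : ℝ) :
    p - algebraMap ℝ _ c = p + algebraMap ℝ _ (-c) := by
  rw [map_neg, sub_eq_add_neg]

theorem evalMat_zero {ι : Type} [Fintype ι] [DecidableEq ι] (p : FreeAlgebra ℝ (Fin g)) :
    evalMat p (fun _ => (0 : Matrix ι ι ℝ)) = constantTerm p • 1 := by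
  have : FreeAlgebra.lift ℝ (fun _ : Fin g => (0 : Matrix ι ι ℝ)) =
      (Algebra.ofId ℝ (Matrix ι ι ℝ)).comp (FreeAlgebra.lift ℝ fun _ : Fin g => (0 : ℝ)) := by
    ext j
    simp
  rw [evalMat, this, AlgHom.comp_apply, Algebra.ofId_apply, Algebra.algebraMap_eq_smul_one]
  rfl

theorem Cond1.cond4 (h : Cond1 g p) : Cond4 g p := by
  refine ⟨⟨fun n => ?_, fun n hn A hA => ?_⟩,
    fun hSOS => hSOS.2 (h.eq_zero_of_isHermitianSOS hSOS.1)⟩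
  · rw [evalMat_zero, sub_algebraMap_eq, constantTerm_add_algebraMap, add_neg_cancel, zero_smul]
  · rw [sub_algebraMap_eq]
    exact h.cond2.cond3.convex_add_algebraMap _ hn hA

theorem Cond4.cond1 (hsym : star p = p) (h : Cond4 g p) : Cond1 g p := by
  obtain ⟨⟨-, hq⟩, hSOS⟩ := h
  by_cases hneg : IsHermitianSOS (algebraMap ℝ (FreeAlgebra ℝ (Fin g)) (constantTerm p) - p)
  · have h0 : algebraMap ℝ (FreeAlgebra ℝ (Fin g)) (constantTerm p) - p = 0 :=
      not_not.1 fun h0 => hSOS ⟨hneg, h0⟩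
    exact ⟨0, 0, Fin.elim0, Submodule.zero_mem _, fun j => j.elim0, by
      rw [← neg_sub, h0]
      simp⟩
  · rw [← neg_sub] at hneg
    rw [sub_algebraMap_eq] at hneg hq
    exact Cond1.of_add_algebraMap (cond1_of_convex (star_add_algebraMap hsym _) hq hneg)

end Implications

/-- for a symmetric free polynomial `p`, conditions (i)-(iv) are equivalent. -/
theorem stmt_3 (g : ℕ) (p : FreeAlgebra ℝ (Fin g)) (hsym : star p = p) :
    List.TFAE [Cond1 g p, Cond2 g p, Cond3 g p, Cond4 g p] := by
  tfae_have 1 → 2 := Cond1.cond2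
  tfae_have 2 → 3 := Cond2.cond3
  tfae_have 3 → 1 := Cond3.cond1 hsym
  tfae_have 1 → 4 := Cond1.cond4
  tfae_have 4 → 1 := Cond4.cond1 hsym
  tfae_finish
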